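/- Let n ≥ 1 and let f : (Fin n → Bool) → Bool. Define f' : ((Fin n → Bool) × Bool) → Bool by f'(x, y) = true if and only if either (y = true and f(x) = true) or (y = false and x(i) = true for all i). Then f' has at least one model; let P be the uniform distribution on the set of models of f'. For every probability distribution Q on (Fin n → Bool) × Bool with D_TV(P,Q) < 1/4, the function f is satisfiable if and only if Q({(x,y) : y = true}) ≥ 1/4. (Correctness of the SAT reduction underlying Theorem 3.3 and Corollary 3.4.) -/

import Mathlib

/-- The probabilities of an event under two functions of equal total mass differ by at most
their total variation distance. -/
lemma abs_sum_filter_sub_le_half_sum_abs {Ω : Type*} [Fintype Ω] (P Q : Ω → ℝ)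
    (h : ∑ p, P p = ∑ p, Q p) (E : Ω → Prop) [DecidablePred E] :
    |∑ p ∈ Finset.univ.filter E, P p - ∑ p ∈ Finset.univ.filter E, Q p| ≤
      (1 / 2) * ∑ p, |P p - Q p| := by
  have hP := Finset.sum_filter_add_sum_filter_not Finset.univ E P
  have hQ := Finset.sum_filter_add_sum_filter_not Finset.univ E Q
  have hD := Finset.sum_filter_add_sum_filter_not Finset.univ E (fun p => |P p - Q p|)
  have h1 := Finset.abs_sum_le_sum_abs (fun p => P p - Q p) (Finset.univ.filter E)
  have h2 := Finset.abs_sum_le_sum_abs (fun p => P p - Q p)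
    (Finset.univ.filter (fun p => ¬ E p))
  rw [Finset.sum_sub_distrib] at h1 h2
  rw [abs_le] at h1 h2 ⊢
  constructor <;> linarith [h1.1, h1.2, h2.1, h2.2]


/-- Correctness of the SAT reduction underlying Theorem 3.3 and Corollary 3.4. -/
theorem sat_reduction_correctness {n : ℕ} (hn : 1 ≤ n)
    (f : (Fin n → Bool) → Bool)
    (f' : ((Fin n → Bool) × Bool) → Bool)
    (hf' : ∀ x y, f' (x, y) = true ↔
      (y = true ∧ f x = true) ∨ (y = false ∧ ∀ i, x i = true))
    (M : Finset ((Fin n → Bool) × Bool))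
    (hM : M = Finset.univ.filter (fun p => f' p = true))
    (P : ((Fin n → Bool) × Bool) → ℝ)
    (hP : ∀ p, P p = if p ∈ M then (M.card : ℝ)⁻¹ else 0) :
    M.Nonempty ∧
      ∀ Q : ((Fin n → Bool) × Bool) → ℝ,
        (∀ p, 0 ≤ Q p) → (∑ p, Q p = 1) →
        (1 / 2) * (∑ p, |P p - Q p|) < 1 / 4 →
        ((∃ x, f x = true) ↔
          (1 / 4 : ℝ) ≤
            ∑ p ∈ Finset.univ.filter
              (fun p : (Fin n → Bool) × Bool => p.2 = true), Q p) := by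
  have hmem : ∀ x y, (x, y) ∈ M ↔
      (y = true ∧ f x = true) ∨ (y = false ∧ ∀ i, x i = true) := by
    intro x y
    rw [hM, Finset.mem_filter, ← hf']
    simp
  have ha : ((fun _ => true, false) : (Fin n → Bool) × Bool) ∈ M := by simp [hmem]
  refine ⟨⟨_, ha⟩, fun Q _ hQ1 hTV => ?_⟩
  have hcard : (M.card : ℝ) ≠ 0 := by
    exact_mod_cast (Finset.card_pos.mpr ⟨_, ha⟩).ne'
  have hP1 : ∑ p, P p = 1 := by
    simp [hP, hcard]
  have hE := (abs_sum_filter_sub_le_half_sum_abs P Q (hP1.trans hQ1.symm)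
    (fun p => p.2 = true)).trans_lt hTV
  rw [abs_lt] at hE
  constructor
  · rintro ⟨x, hx⟩
    have hx' : (x, true) ∈ M := by simp [hmem, hx]
    have hcard2 : (2 : ℝ) ≤ M.card := by
      exact_mod_cast Finset.one_lt_card.mpr ⟨_, ha, _, hx', by simp⟩
    have hfalse : ∑ p ∈ Finset.univ.filter
        (fun p : (Fin n → Bool) × Bool => ¬ p.2 = true), P p = (M.card : ℝ)⁻¹ := by
      rw [Finset.sum_eq_single (fun _ => true, false), hP, if_pos ha]
      · rintro ⟨z, y⟩ hy hne
        rw [hP, if_neg]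
        intro hz
        rcases (hmem z y).mp hz with ⟨hy', _⟩ | ⟨hy', hz'⟩
        · simp [hy'] at hy
        · exact hne (Prod.ext (funext hz') hy')
      · simp
    have hinv : (M.card : ℝ)⁻¹ ≤ 2⁻¹ := inv_anti₀ (by norm_num) hcard2
    have hsplit := Finset.sum_filter_add_sum_filter_not Finset.univ
      (fun p : (Fin n → Bool) × Bool => p.2 = true) P
    linarith [hE.2]
  · intro hQE
    by_contra hunsat
    have htrue : ∑ p ∈ Finset.univ.filter
        (fun p : (Fin n → Bool) × Bool => p.2 = true), P p = 0 := by
      refine Finset.sum_eq_zero ?_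
      rintro ⟨z, y⟩ hy
      rw [hP, if_neg]
      intro hz
      rcases (hmem z y).mp hz with ⟨_, hz'⟩ | ⟨hy', _⟩
      · exact hunsat ⟨z, hz'⟩
      · simp [hy'] at hy
    linarith [hE.1]
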